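/- arXiv:1409.0564 — 2 statements merged into one kernel-verified Lean document; each statement's English description precedes it below -/
import Mathlib

section
/- Let p, q, r be nonzero real numbers and fix n. If the map (A,B,C) ↦ Tr[A^{q/2} B^p A^{q/2} C^r] is jointly convex on triples of n×n positive definite complex matrices, then the operator-valued map (A,B) ↦ A^{q/2} B^p A^{q/2} is jointly operator convex on pairs of n×n positive definite complex matrices. -/
open Matrix
open scoped ComplexOrder

/-- Real power of a matrix, defined via the spectral decomposition when the matrix is
Hermitian (junk value `0` otherwise). For a positive (semi-)definite matrix this is the
usual real power given by the spectral functional calculus (with `0 ^ r = 0`). -/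
noncomputable def mpow {n : ℕ} (A : Matrix (Fin n) (Fin n) ℂ) (r : ℝ) :
    Matrix (Fin n) (Fin n) ℂ :=
  if h : A.IsHermitian then
    (h.eigenvectorUnitary : Matrix (Fin n) (Fin n) ℂ) *
      Matrix.diagonal (fun i => ((h.eigenvalues i ^ r : ℝ) : ℂ)) *
      (star h.eigenvectorUnitary : Matrix (Fin n) (Fin n) ℂ)
  else 0

/-- `Tr[A^{q/2} B^p A^{q/2} C^r]` (as a real number). -/
noncomputable def trTriple {n : ℕ} (p q r : ℝ) (A B C : Matrix (Fin n) (Fin n) ℂ) : ℝ :=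
  (Matrix.trace (mpow A (q / 2) * mpow B p * mpow A (q / 2) * mpow C r)).re

/-- Joint convexity of a real-valued function of three positive definite matrices. -/
def JointlyConvex3 {n : ℕ}
    (f : Matrix (Fin n) (Fin n) ℂ → Matrix (Fin n) (Fin n) ℂ → Matrix (Fin n) (Fin n) ℂ → ℝ) :
    Prop :=
  ∀ A₁ A₂ B₁ B₂ C₁ C₂ : Matrix (Fin n) (Fin n) ℂ,
    A₁.PosDef → A₂.PosDef → B₁.PosDef → B₂.PosDef → C₁.PosDef → C₂.PosDef →
    ∀ t : ℝ, 0 ≤ t → t ≤ 1 →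
      f (t • A₁ + (1 - t) • A₂) (t • B₁ + (1 - t) • B₂) (t • C₁ + (1 - t) • C₂) ≤
        t * f A₁ B₁ C₁ + (1 - t) * f A₂ B₂ C₂

/-- Joint concavity of a real-valued function of three positive definite matrices. -/
def JointlyConcave3 {n : ℕ}
    (f : Matrix (Fin n) (Fin n) ℂ → Matrix (Fin n) (Fin n) ℂ → Matrix (Fin n) (Fin n) ℂ → ℝ) :
    Prop :=
  ∀ A₁ A₂ B₁ B₂ C₁ C₂ : Matrix (Fin n) (Fin n) ℂ,
    A₁.PosDef → A₂.PosDef → B₁.PosDef → B₂.PosDef → C₁.PosDef → C₂.PosDef →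
    ∀ t : ℝ, 0 ≤ t → t ≤ 1 →
      t * f A₁ B₁ C₁ + (1 - t) * f A₂ B₂ C₂ ≤
        f (t • A₁ + (1 - t) • A₂) (t • B₁ + (1 - t) • B₂) (t • C₁ + (1 - t) • C₂)

/-- Joint operator convexity (in the Loewner order) of a matrix-valued function of two
positive definite matrices. -/
def JointlyOpConvex {n : ℕ}
    (F : Matrix (Fin n) (Fin n) ℂ → Matrix (Fin n) (Fin n) ℂ → Matrix (Fin n) (Fin n) ℂ) :
    Prop :=
  ∀ A₁ A₂ B₁ B₂ : Matrix (Fin n) (Fin n) ℂ,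
    A₁.PosDef → A₂.PosDef → B₁.PosDef → B₂.PosDef →
    ∀ t : ℝ, 0 ≤ t → t ≤ 1 →
      (t • F A₁ B₁ + (1 - t) • F A₂ B₂ -
        F (t • A₁ + (1 - t) • A₂) (t • B₁ + (1 - t) • B₂)).PosSemidef

theorem isHermitian_mpow {n : ℕ} (A : Matrix (Fin n) (Fin n) ℂ) (s : ℝ) :
    (mpow A s).IsHermitian := by
  unfold mpow
  split_ifs with h
  · refine isHermitian_mul_mul_conjTranspose _ (isHermitian_diagonal_of_self_adjoint _ ?_)
    ext i
    simp
  · exact isHermitian_zero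

theorem mpow_eq_cfc {n : ℕ} {A : Matrix (Fin n) (Fin n) ℂ} (hA : A.IsHermitian) (s : ℝ) :
    mpow A s = cfc (fun x : ℝ => x ^ s) A := by
  rw [hA.cfc_eq, IsHermitian.cfc, Unitary.conjStarAlgAut_apply, mpow, dif_pos hA]
  rfl

theorem Matrix.PosDef.mpow {n : ℕ} {A : Matrix (Fin n) (Fin n) ℂ} (hA : A.PosDef) (s : ℝ) :
    (mpow A s).PosDef := by
  rw [_root_.mpow, dif_pos hA.1]
  refine (IsUnit.posDef_star_right_conjugate_iff
    (Unitary.isUnit_coe (U := hA.1.eigenvectorUnitary))).2 (PosDef.diagonal fun i => ?_)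
  exact_mod_cast Real.rpow_pos_of_pos (hA.eigenvalues_pos i) s

theorem mpow_mpow_of_mul_eq_one {n : ℕ} {A : Matrix (Fin n) (Fin n) ℂ} (hA : A.PosDef)
    {s r : ℝ} (h : s * r = 1) : mpow (mpow A s) r = A := by
  have hsa : IsSelfAdjoint A := hA.1
  rw [mpow_eq_cfc (isHermitian_mpow A s), mpow_eq_cfc hA.1,
    ← cfc_comp (fun x : ℝ => x ^ r) (fun x : ℝ => x ^ s) A hsa
      ((A.finite_real_spectrum.image _).continuousOn _) (A.finite_real_spectrum.continuousOn _)]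
  conv_rhs => rw [← cfc_id ℝ A]
  refine cfc_congr fun x hx => ?_
  rw [hA.1.spectrum_real_eq_range_eigenvalues] at hx
  obtain ⟨i, rfl⟩ := hx
  simp [← Real.rpow_mul (hA.eigenvalues_pos i).le, h]

/-- A Hermitian matrix whose trace pairing with every positive definite matrix is nonnegative is
positive semidefinite. -/
theorem Matrix.IsHermitian.posSemidef_of_trace_mul_posDef_nonneg {n : Type*} [Fintype n]
    [DecidableEq n] {D : Matrix n n ℂ} (hD : D.IsHermitian)
    (h : ∀ K : Matrix n n ℂ, K.PosDef → 0 ≤ (D * K).trace.re) : D.PosSemidef := by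
  refine .of_dotProduct_mulVec_nonneg hD fun x => ?_
  have hre : 0 ≤ (star x ⬝ᵥ (D *ᵥ x)).re := by
    have key (ε : ℝ) (hε : 0 < ε) : 0 ≤ (star x ⬝ᵥ (D *ᵥ x)).re + ε * D.trace.re := by
      have hK : (vecMulVec x (star x) + ε • (1 : Matrix n n ℂ)).PosDef :=
        PosDef.posSemidef_add (posSemidef_vecMulVec_self_star x) (PosDef.one.smul hε)
      have := h _ hK
      rwa [mul_add, mul_vecMulVec, trace_add, trace_vecMulVec, mul_smul_comm, mul_one,
        trace_smul, dotProduct_comm, Complex.add_re, Complex.smul_re, smul_eq_mul] at this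
    have hlim : Filter.Tendsto (fun ε : ℝ => (star x ⬝ᵥ (D *ᵥ x)).re + ε * D.trace.re)
        (nhdsWithin 0 (Set.Ioi 0)) (nhds ((star x ⬝ᵥ (D *ᵥ x)).re + 0 * D.trace.re)) :=
      (Continuous.tendsto (by fun_prop) 0).mono_left nhdsWithin_le_nhds
    simpa using ge_of_tendsto hlim (Filter.eventually_of_mem self_mem_nhdsWithin key)
  exact Complex.nonneg_iff.2 ⟨hre, (hD.im_star_dotProduct_mulVec_self x).symm⟩

/-- Lemma 3.1, convex case: trace convexity of `(A,B,C) ↦ Tr[A^{q/2} B^p A^{q/2} C^r]`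
implies joint operator convexity of `(A,B) ↦ A^{q/2} B^p A^{q/2}`. -/
theorem trace_convex_implies_operator_convex (p q r : ℝ) (hp : p ≠ 0) (hq : q ≠ 0)
    (hr : r ≠ 0) (n : ℕ) (hconv : JointlyConvex3 (trTriple (n := n) p q r)) :
    JointlyOpConvex (fun A B : Matrix (Fin n) (Fin n) ℂ =>
      mpow A (q / 2) * mpow B p * mpow A (q / 2)) := by
  intro A₁ A₂ B₁ B₂ hA₁ hA₂ hB₁ hB₂ t ht₀ ht₁
  have hF (A B : Matrix (Fin n) (Fin n) ℂ) :
      (mpow A (q / 2) * mpow B p * mpow A (q / 2)).IsHermitian := by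
    simpa only [(isHermitian_mpow A (q / 2)).eq] using
      isHermitian_mul_mul_conjTranspose (mpow A (q / 2)) (isHermitian_mpow B p)
  refine IsHermitian.posSemidef_of_trace_mul_posDef_nonneg
    ((((hF _ _).smul (IsSelfAdjoint.all t)).add ((hF _ _).smul (IsSelfAdjoint.all (1 - t)))).sub
      (hF _ _)) fun K hK => ?_
  have hC := hK.mpow r⁻¹
  have h := hconv A₁ A₂ B₁ B₂ _ _ hA₁ hA₂ hB₁ hB₂ hC hC t ht₀ ht₁
  simp only [trTriple, ← add_smul, add_sub_cancel, one_smul,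
    mpow_mpow_of_mul_eq_one hK (inv_mul_cancel₀ hr)] at h
  simp only [sub_mul _ _ K, add_mul _ _ K, smul_mul_assoc _ _ K, trace_sub, trace_add, trace_smul,
    Complex.sub_re, Complex.add_re, Complex.smul_re, smul_eq_mul]
  linarith
end

section
/- Let p, q be nonzero real numbers and fix n ≥ 2. The map (A,B) ↦ A^{q/2} B^p A^{q/2} from pairs of n×n positive definite complex matrices to matrices is jointly operator convex if and only if q = 2 and −1 ≤ p < 0. -/
open Matrix
open scoped ComplexOrder

section

open scoped MatrixOrder Matrix.Norms.L2Operator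

theorem mpow_eq_rpow {n : ℕ} {A : Matrix (Fin n) (Fin n) ℂ} (hA : A.PosSemidef) (r : ℝ) :
    mpow A r = A ^ r := by
  rw [CFC.rpow_eq_cfc_real (nonneg_iff_posSemidef.2 hA), hA.1.cfc_eq, IsHermitian.cfc, mpow,
    dif_pos hA.1, Unitary.conjStarAlgAut_apply]
  rfl

theorem mpow_one {n : ℕ} {A : Matrix (Fin n) (Fin n) ℂ} (hA : A.PosSemidef) :
    mpow A 1 = A := by
  rw [mpow_eq_rpow hA, CFC.rpow_one A (nonneg_iff_posSemidef.2 hA)]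

theorem mpow_posDef {n : ℕ} {A : Matrix (Fin n) (Fin n) ℂ} (hA : A.PosDef) (r : ℝ) :
    (mpow A r).PosDef := by
  rw [mpow_eq_rpow hA.posSemidef]
  exact isStrictlyPositive_iff_posDef.1
    (IsStrictlyPositive.rpow A r (isStrictlyPositive_iff_posDef.2 hA))

theorem mpow_inv_mpow {n : ℕ} {A : Matrix (Fin n) (Fin n) ℂ} (hA : A.PosDef) {r : ℝ}
    (hr : r ≠ 0) : mpow (mpow A r⁻¹) r = A := by
  rw [mpow_eq_rpow (mpow_posDef hA _).posSemidef, mpow_eq_rpow hA.posSemidef,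
    CFC.rpow_inv_rpow A r hr (isStrictlyPositive_iff_posDef.2 hA)]

theorem mpow_neg {n : ℕ} {A : Matrix (Fin n) (Fin n) ℂ} (hA : A.PosDef) (r : ℝ) :
    mpow A (-r) = (mpow A r)⁻¹ := by
  rw [mpow_eq_rpow hA.posSemidef, mpow_eq_rpow hA.posSemidef]
  exact (Matrix.inv_eq_left_inv
    (CFC.rpow_neg_mul_rpow r (isStrictlyPositive_iff_posDef.2 hA))).symm

theorem mpow_diagonal {n : ℕ} (d : Fin n → ℝ) (r : ℝ) :
    mpow (diagonal fun i => (d i : ℂ)) r = diagonal fun i => ((d i ^ r : ℝ) : ℂ) := by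
  have h : (diagonal fun i => (d i : ℂ)).IsHermitian := by
    simp [IsHermitian, diagonal_conjTranspose, Pi.star_def]
  have hU : (diagonal fun i => (d i : ℂ)) * (h.eigenvectorUnitary : Matrix (Fin n) (Fin n) ℂ) =
      h.eigenvectorUnitary * diagonal fun i => (h.eigenvalues i : ℂ) := by
    conv_lhs => enter [1]; rw [h.spectral_theorem, Unitary.conjStarAlgAut_apply]
    rw [mul_assoc, Unitary.coe_star_mul_self, mul_one]
    rfl
  have hV : (h.eigenvectorUnitary : Matrix (Fin n) (Fin n) ℂ) *
      (diagonal fun i => ((h.eigenvalues i ^ r : ℝ) : ℂ)) =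
      (diagonal fun i => ((d i ^ r : ℝ) : ℂ)) * h.eigenvectorUnitary := by
    ext i j
    have hij := congrFun (congrFun hU i) j
    rw [diagonal_mul, mul_diagonal] at hij ⊢
    by_cases h0 : (h.eigenvectorUnitary : Matrix (Fin n) (Fin n) ℂ) i j = 0
    · rw [h0, zero_mul, mul_zero]
    · rw [mul_comm, mul_right_inj' h0] at hij
      rw [Complex.ofReal_inj.1 hij, mul_comm]
  rw [mpow, dif_pos h, hV, mul_assoc,
    Unitary.mul_star_self_of_mem (SetLike.coe_mem h.eigenvectorUnitary), mul_one]

theorem rpow_midpoint_lt {r x y : ℝ} (hr : r < 0 ∨ 1 < r) (hx : 0 < x) (hy : 0 < y)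
    (hxy : x ≠ y) : ((x + y) / 2) ^ r < (x ^ r + y ^ r) / 2 := by
  rcases hr with hr | hr
  · have hm : 0 < (x + y) / 2 := by positivity
    have h1 : (((x + y) / 2) * ((x + y) / 2)) ^ r < (x * y) ^ r :=
      Real.rpow_lt_rpow_of_neg (by positivity)
        (by nlinarith [sq_pos_of_ne_zero (sub_ne_zero.2 hxy)]) hr
    rw [Real.mul_rpow hm.le hm.le, Real.mul_rpow hx.le hy.le] at h1
    have := Real.rpow_pos_of_pos hx r
    have := Real.rpow_pos_of_pos hy r
    refine lt_of_pow_lt_pow_left₀ 2 (by positivity) ?_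
    nlinarith [sq_nonneg (x ^ r - y ^ r)]
  · have := (strictConvexOn_rpow hr).2 hx.le hy.le hxy (one_half_pos (α := ℝ)) one_half_pos
      (by norm_num)
    simp only [smul_eq_mul] at this
    rw [show (x + y) / 2 = 1 / 2 * x + 1 / 2 * y by ring]
    linarith

theorem jointlyOpConvex_mpow_one {n : ℕ} {p : ℝ} (hp : -1 ≤ p) (hp' : p < 0) :
    JointlyOpConvex fun A B : Matrix (Fin n) (Fin n) ℂ => mpow A 1 * mpow B p * mpow A 1 := by
  intro A₁ A₂ B₁ B₂ hA₁ hA₂ hB₁ hB₂ t ht ht'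
  have ht'' : 0 ≤ 1 - t := sub_nonneg.2 ht'
  have hBp : (t • B₁ + (1 - t) • B₂).PosDef := by
    rcases ht.eq_or_lt with rfl | ht0
    · simpa using hB₂
    · exact (hB₁.smul ht0).add_posSemidef (hB₂.posSemidef.smul ht'')
  have hAp : (t • A₁ + (1 - t) • A₂).PosSemidef :=
    (hA₁.posSemidef.smul ht).add (hA₂.posSemidef.smul ht'')
  simp only [mpow_one hA₁.posSemidef, mpow_one hA₂.posSemidef, mpow_one hAp]
  obtain ⟨s, rfl⟩ : ∃ s, p = -s := ⟨-p, by simp⟩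
  have hblock : ∀ A B : Matrix (Fin n) (Fin n) ℂ, A.IsHermitian → B.PosDef →
      (fromBlocks (A * mpow B (-s) * A) A A (mpow B s)).PosSemidef := by
    intro A B hA hB
    have hD := mpow_posDef hB s
    have := hD.isUnit.invertible
    have := (PosDef.fromBlocks₂₂ (A * mpow B (-s) * A) A hD).2
      (by rw [mpow_neg hB, hA.eq, sub_self]; exact PosSemidef.zero)
    rwa [hA.eq] at this
  have hconc : (mpow (t • B₁ + (1 - t) • B₂) s -
      (t • mpow B₁ s + (1 - t) • mpow B₂ s)).PosSemidef := by
    rw [mpow_eq_rpow hBp.posSemidef, mpow_eq_rpow hB₁.posSemidef, mpow_eq_rpow hB₂.posSemidef]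
    exact (CFC.concaveOn_rpow (A := Matrix (Fin n) (Fin n) ℂ) (p := s)
      ⟨by linarith, by linarith⟩).2 (nonneg_iff_posSemidef.2 hB₁.posSemidef)
      (nonneg_iff_posSemidef.2 hB₂.posSemidef) ht ht'' (by ring)
  have hzero : (fromBlocks (0 : Matrix (Fin n) (Fin n) ℂ) 0 0 (mpow (t • B₁ + (1 - t) • B₂) s -
      (t • mpow B₁ s + (1 - t) • mpow B₂ s))).PosSemidef := by
    have := PosSemidef.conjTranspose_mul_mul_same hconc
      (fromCols (0 : Matrix (Fin n) (Fin n) ℂ) (1 : Matrix (Fin n) (Fin n) ℂ))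
    rw [conjTranspose_fromCols_eq_fromRows_conjTranspose, fromRows_mul,
      fromRows_mul_fromCols] at this
    simpa using this
  have hsum := (((hblock A₁ B₁ hA₁.1 hB₁).smul ht).add
    ((hblock A₂ B₂ hA₂.1 hB₂).smul ht'')).add hzero
  simp only [fromBlocks_smul, fromBlocks_add, add_zero, add_sub_cancel] at hsum
  have hD := mpow_posDef hBp s
  have := hD.isUnit.invertible
  have := (PosDef.fromBlocks₂₂ (t • (A₁ * mpow B₁ (-s) * A₁) + (1 - t) • (A₂ * mpow B₂ (-s) * A₂))
    (t • A₁ + (1 - t) • A₂) hD).1 (by rwa [hAp.1.eq])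
  rwa [hAp.1.eq, ← mpow_neg hBp] at this

end

theorem dotProduct_diagonal_mul_mul_diagonal {n : ℕ} (v d : Fin n → ℝ) (δ : ℝ) :
    (star (1 : Fin n → ℂ) ⬝ᵥ ((diagonal fun i => (d i : ℂ)) *
      (vecMulVec (fun i => (v i : ℂ)) (fun i => (v i : ℂ)) + δ • 1) *
      (diagonal fun i => (d i : ℂ))) *ᵥ 1).re = (∑ i, v i * d i) ^ 2 + δ * ∑ i, d i ^ 2 := by
  have h : (star (1 : Fin n → ℂ) ⬝ᵥ ((diagonal fun i => (d i : ℂ)) *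
      (vecMulVec (fun i => (v i : ℂ)) (fun i => (v i : ℂ)) + δ • 1) *
      (diagonal fun i => (d i : ℂ))) *ᵥ 1) =
      (((∑ i, v i * d i) ^ 2 + δ * ∑ i, d i ^ 2 : ℝ) : ℂ) := by
    simp only [dotProduct, mulVec, diagonal_mul, mul_diagonal, Matrix.add_apply, vecMulVec_apply,
      Matrix.smul_apply, Matrix.one_apply, Pi.star_apply, Pi.one_apply, star_one, one_mul, mul_one,
      add_mul, mul_add, Finset.sum_add_distrib]
    push_cast
    congr 1
    · rw [sq, Finset.sum_mul_sum]
      exact Finset.sum_congr rfl fun i _ => Finset.sum_congr rfl fun j _ => by ring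
    · rw [Finset.mul_sum]
      refine Finset.sum_congr rfl fun i _ => ?_
      simp [ite_mul, mul_ite]
      ring
  rw [h, Complex.ofReal_re]

theorem sq_midpoint_le_of_jointlyOpConvex {n : ℕ} {p r : ℝ} (hp : p ≠ 0)
    (h : JointlyOpConvex fun A B : Matrix (Fin n) (Fin n) ℂ => mpow A r * mpow B p * mpow A r)
    (v x y : Fin n → ℝ) (hx : ∀ i, 0 < x i) (hy : ∀ i, 0 < y i) :
    (∑ i, v i * ((x i + y i) / 2) ^ r) ^ 2 ≤
      ((∑ i, v i * x i ^ r) ^ 2 + (∑ i, v i * y i ^ r) ^ 2) / 2 := by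
  have hdiag : ∀ d : Fin n → ℝ, (∀ i, 0 < d i) →
      (diagonal fun i => (d i : ℂ)).PosDef := fun d hd =>
    PosDef.diagonal fun i => by exact_mod_cast hd i
  have key : ∀ δ : ℝ, 0 < δ → (∑ i, v i * ((x i + y i) / 2) ^ r) ^ 2 ≤
      ((∑ i, v i * x i ^ r) ^ 2 + (∑ i, v i * y i ^ r) ^ 2) / 2 +
        δ * ((∑ i, (x i ^ r) ^ 2 + ∑ i, (y i ^ r) ^ 2) / 2) := by
    intro δ hδ
    have hC : (vecMulVec (fun i => (v i : ℂ)) (fun i => (v i : ℂ)) +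
        δ • (1 : Matrix (Fin n) (Fin n) ℂ)).PosDef := by
      refine PosDef.posSemidef_add ?_ (PosDef.one.smul hδ)
      have := posSemidef_vecMulVec_self_star (fun i => (v i : ℂ))
      simpa [Pi.star_def] using this
    have hB := mpow_posDef hC p⁻¹
    have hmid := h _ _ _ _ (hdiag x hx) (hdiag y hy) hB hB (1 / 2) (by norm_num) (by norm_num)
    have hd : (1 / 2 : ℝ) • (diagonal fun i => (x i : ℂ)) +
        (1 - 1 / 2 : ℝ) • (diagonal fun i => (y i : ℂ)) =
        diagonal fun i => (((x i + y i) / 2 : ℝ) : ℂ) := by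
      ext i j
      by_cases hij : i = j
      · subst hij; simp; ring
      · simp [hij]
    simp only [← add_smul, hd, mpow_diagonal, mpow_inv_mpow hC hp, add_sub_cancel, one_smul] at hmid
    have hre := (Complex.le_def.1 (hmid.dotProduct_mulVec_nonneg 1)).1
    simp only [sub_mulVec, add_mulVec, smul_mulVec, dotProduct_sub, dotProduct_add,
      dotProduct_smul, Complex.sub_re, Complex.add_re, Complex.smul_re,
      dotProduct_diagonal_mul_mul_diagonal, Complex.zero_re, smul_eq_mul] at hre
    have : 0 ≤ δ * ∑ i, (((x i + y i) / 2) ^ r) ^ 2 := by positivity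
    linarith
  refine le_of_forall_pos_le_add fun ε hε => ?_
  have hK : 0 ≤ (∑ i, (x i ^ r) ^ 2 + ∑ i, (y i ^ r) ^ 2) / 2 := by positivity
  generalize (∑ i, (x i ^ r) ^ 2 + ∑ i, (y i ^ r) ^ 2) / 2 = K at key hK
  refine (key (ε / (K + 1)) (by positivity)).trans ?_
  gcongr
  rw [div_mul_eq_mul_div, div_le_iff₀ (by positivity)]
  nlinarith

theorem sq_add_midpoint_le_of_jointlyOpConvex {n : ℕ} (hn : 2 ≤ n) {p r : ℝ} (hp : p ≠ 0)
    (h : JointlyOpConvex fun A B : Matrix (Fin n) (Fin n) ℂ => mpow A r * mpow B p * mpow A r)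
    (α β : ℝ) {x₀ x₁ y₀ y₁ : ℝ} (hx₀ : 0 < x₀) (hx₁ : 0 < x₁) (hy₀ : 0 < y₀) (hy₁ : 0 < y₁) :
    (α * ((x₀ + y₀) / 2) ^ r + β * ((x₁ + y₁) / 2) ^ r) ^ 2 ≤
      ((α * x₀ ^ r + β * x₁ ^ r) ^ 2 + (α * y₀ ^ r + β * y₁ ^ r) ^ 2) / 2 := by
  obtain ⟨m, rfl⟩ := Nat.exists_eq_add_of_le' hn
  have := sq_midpoint_le_of_jointlyOpConvex hp h
    (Fin.cons α (Fin.cons β fun _ => 0)) (Fin.cons x₀ fun _ => x₁) (Fin.cons y₀ fun _ => y₁)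
    (Fin.cases hx₀ fun _ => hx₁) (Fin.cases hy₀ fun _ => hy₁)
  simpa [Fin.sum_univ_succ] using this

theorem eq_one_of_jointlyOpConvex {n : ℕ} (hn : 2 ≤ n) {p r : ℝ} (hp : p ≠ 0) (hr : r ≠ 0)
    (h : JointlyOpConvex fun A B : Matrix (Fin n) (Fin n) ℂ => mpow A r * mpow B p * mpow A r) :
    r = 1 := by
  by_contra hr1
  have key := sq_add_midpoint_le_of_jointlyOpConvex hn hp h
  by_cases hcase : r < 0 ∨ 1 < r
  · have hbound : ∀ z : ℝ, 0 < 1 + z → 0 < 1 + 2 * z → z ≠ 0 →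
        2 * (1 + z) ^ r - (1 + 2 * z) ^ r < 1 := by
      intro z hz hz' hz0
      have := rpow_midpoint_lt hcase one_pos hz' (by simpa using hz0)
      rw [Real.one_rpow, show (1 + (1 + 2 * z)) / 2 = 1 + z by ring] at this
      linarith
    have hcont : ContinuousAt (fun z : ℝ => 2 * (1 + z) ^ r - (1 + 2 * z) ^ r) 0 := by
      refine .sub (.mul continuousAt_const (.rpow_const (by fun_prop) (.inl (by norm_num))))
        (.rpow_const (by fun_prop) (.inl (by norm_num)))
    have hlow : ∀ᶠ z : ℝ in nhds 0, -1 < 2 * (1 + z) ^ r - (1 + 2 * z) ^ r :=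
      hcont.eventually_const_lt (by norm_num)
    obtain ⟨ε, hε, hball⟩ := Metric.eventually_nhds_iff.1 hlow
    obtain ⟨z, hz0, hzε, hz⟩ : ∃ z : ℝ, 0 < z ∧ z < ε ∧ z < 1 / 2 :=
      ⟨min ε (1 / 2) / 2, by positivity, by linarith [min_le_left ε (1 / 2)],
        by linarith [min_le_right ε (1 / 2)]⟩
    have h₁ := hbound z (by linarith) (by linarith) hz0.ne'
    have h₂ := hbound (-z) (by linarith) (by linarith) (by simpa using hz0.ne')
    have h₃ := hball (y := z) (by simpa [abs_of_pos hz0] using hzε)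
    have h₄ := hball (y := -z) (by simpa [abs_of_pos hz0] using hzε)
    have := key 2 (-1) (x₀ := 1 + z) (x₁ := 1 + 2 * z) (y₀ := 1 + -z) (y₁ := 1 + 2 * -z)
      (by linarith) (by linarith) (by linarith) (by linarith)
    rw [show (1 + z + (1 + -z)) / 2 = 1 by ring, show (1 + 2 * z + (1 + 2 * -z)) / 2 = 1 by ring,
      Real.one_rpow] at this
    nlinarith
  · push Not at hcase
    have hr0 : 0 < r := lt_of_le_of_ne hcase.1 hr.symm
    have hc := (Real.strictConcaveOn_rpow hr0 (lt_of_le_of_ne hcase.2 hr1)).2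
      (by norm_num : (1 / 2 : ℝ) ∈ Set.Ici 0) (by norm_num : (3 / 2 : ℝ) ∈ Set.Ici 0)
      (by norm_num) one_half_pos one_half_pos (by norm_num)
    have := key 1 1 (x₀ := 1 / 2) (x₁ := 3 / 2) (y₀ := 3 / 2) (y₁ := 1 / 2)
      (by norm_num) (by norm_num) (by norm_num) (by norm_num)
    norm_num only [smul_eq_mul, Real.one_rpow] at this hc
    have := Real.rpow_pos_of_pos (x := 1 / 2) (by norm_num) r
    have := Real.rpow_pos_of_pos (x := 3 / 2) (by norm_num) r
    nlinarith

theorem rpow_midpoint_ge_of_jointlyOpConvex {n : ℕ} (hn : 0 < n) {p : ℝ}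
    (h : JointlyOpConvex fun A B : Matrix (Fin n) (Fin n) ℂ => mpow A 1 * mpow B p * mpow A 1)
    {x y : ℝ} (hx : 0 < x) (hy : 0 < y) :
    (x ^ (-p) + y ^ (-p)) / 2 ≤ ((x + y) / 2) ^ (-p) := by
  have hdiag : ∀ d : ℝ, 0 < d →
      (diagonal fun _ : Fin n => (d : ℂ)).PosDef := fun d hd =>
    PosDef.diagonal fun i => by exact_mod_cast hd
  have hd : ∀ x y : ℝ, (1 / 2 : ℝ) • (diagonal fun _ : Fin n => (x : ℂ)) +
      (1 - 1 / 2 : ℝ) • (diagonal fun _ : Fin n => (y : ℂ)) =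
      diagonal fun _ : Fin n => (((x + y) / 2 : ℝ) : ℂ) := by
    intro x y
    ext i j
    by_cases hij : i = j
    · subst hij; simp; ring
    · simp [hij]
  have hX := Real.rpow_pos_of_pos hx (-p)
  have hY := Real.rpow_pos_of_pos hy (-p)
  have hM := Real.rpow_pos_of_pos (show 0 < (x + y) / 2 by positivity) (-p)
  have hmid := h _ _ _ _ (hdiag _ hX) (hdiag _ hY) (hdiag x hx) (hdiag y hy) (1 / 2)
    (by norm_num) (by norm_num)
  have hmpow := fun c s : ℝ => mpow_diagonal (fun _ : Fin n => c) s
  simp only [hd, hmpow, Real.rpow_one, diagonal_mul_diagonal, ← Complex.ofReal_mul,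
    diagonal_sub, posSemidef_diagonal_iff, ← Complex.ofReal_sub, Complex.zero_le_real] at hmid
  have hle := hmid ⟨0, hn⟩
  have hp : ∀ z : ℝ, 0 < z → z ^ p = (z ^ (-p))⁻¹ := fun z hz => by
    rw [Real.rpow_neg hz.le, inv_inv]
  rw [hp x hx, hp y hy, hp _ (by positivity)] at hle
  generalize x ^ (-p) = X at *
  generalize y ^ (-p) = Y at *
  generalize ((x + y) / 2) ^ (-p) = M at *
  rw [mul_inv_cancel₀ hX.ne', mul_inv_cancel₀ hY.ne'] at hle
  have h' : (X + Y) / 2 * ((X + Y) / 2) ≤ (X + Y) / 2 * M := by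
    rw [← mul_inv_le_iff₀ hM]
    linarith
  exact le_of_mul_le_mul_left h' (by positivity)

/-- Theorem 3.2 (1): `(A,B) ↦ A^{q/2} B^p A^{q/2}` is jointly operator convex if and
only if `q = 2` and `−1 ≤ p < 0`. -/
theorem operator_convex_iff (p q : ℝ) (hp : p ≠ 0) (hq : q ≠ 0) (n : ℕ) (hn : 2 ≤ n) :
    JointlyOpConvex (fun A B : Matrix (Fin n) (Fin n) ℂ =>
        mpow A (q / 2) * mpow B p * mpow A (q / 2)) ↔
      (q = 2 ∧ -1 ≤ p ∧ p < 0) := by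
  constructor
  · intro h
    have hq1 := eq_one_of_jointlyOpConvex hn hp (by simpa using hq) h
    rw [hq1] at h
    have hcase : ¬ (-p < 0 ∨ 1 < -p) := fun hc =>
      (rpow_midpoint_lt hc one_pos two_pos (by norm_num)).not_ge
        (rpow_midpoint_ge_of_jointlyOpConvex (by omega) h one_pos two_pos)
    push Not at hcase
    exact ⟨by linarith, by linarith, lt_of_le_of_ne (by linarith) hp⟩
  · rintro ⟨rfl, hp₁, hp₀⟩
    rw [div_self two_ne_zero]
    exact jointlyOpConvex_mpow_one hp₁ hp₀
end
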